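/- Let B, C ⊆ V satisfy B ∩ C = ∅, B ∩ W = ∅ and C ∩ W = ∅. Let b ∈ B and c ∈ C be such that b A^W c and cl_W({b}) ∩ cl_W({c}) = ∅. Then there exist w_b, w_c ∈ W such that w_b C^W w_c, cl_W({b}) ∩ cl_W({w_b}) ≠ ∅ and cl_W({c}) ∩ cl_W({w_c}) ≠ ∅. -/

import Mathlib

/-- The subdiagonal relation `Δ_S`. -/
def diag {V : Type*} (S : Set V) : V → V → Prop := fun a b => a = b ∧ a ∈ S

/-- Foreset `R B = {a : ∃ b ∈ B, a R b}`. -/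
def foreset {V : Type*} (R : V → V → Prop) (B : Set V) : Set V := {a | ∃ b ∈ B, R a b}

/-- Conditional parental relation `E^W = Δ_{V∖W} E`. -/
def condParent {V : Type*} (E : V → V → Prop) (W : Set V) : V → V → Prop :=
  Relation.Comp (diag Wᶜ) E

/-- Conditional ascendent relation `B^W = E (E^W)*`. -/
def condAsc {V : Type*} (E : V → V → Prop) (W : Set V) : V → V → Prop :=
  Relation.Comp E (Relation.ReflTransGen (condParent E W))

/-- `B^{-W} = (B^W)ᵒ`. -/
def condAscConv {V : Type*} (E : V → V → Prop) (W : Set V) : V → V → Prop :=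
  flip (condAsc E W)

/-- Conditional common cause relation `K^W = ((E^W)⁺)ᵒ (E^W)⁺`. -/
def condK {V : Type*} (E : V → V → Prop) (W : Set V) : V → V → Prop :=
  Relation.Comp (flip (Relation.TransGen (condParent E W))) (Relation.TransGen (condParent E W))

/-- Conditional cousinhood relation `C^W = (Δ_W K^W Δ_W)⁺ ∪ Δ_W`. -/
def condC {V : Type*} (E : V → V → Prop) (W : Set V) : V → V → Prop := fun a b =>
  Relation.TransGen (Relation.Comp (Relation.Comp (diag W) (condK E W)) (diag W)) a b ∨
    diag W a b

/-- Conditional active relation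
`A^W = Δ ∪ B^W ∪ B^{-W} ∪ K^W ∪ (B^W ∪ K^W) C^W (B^{-W} ∪ K^W)`. -/
def condA {V : Type*} (E : V → V → Prop) (W : Set V) : V → V → Prop := fun a b =>
  a = b ∨ condAsc E W a b ∨ condAscConv E W a b ∨ condK E W a b ∨
    Relation.Comp
      (Relation.Comp (fun x y => condAsc E W x y ∨ condK E W x y) (condC E W))
      (fun x y => condAscConv E W x y ∨ condK E W x y) a b

/-- The relation `R^W = Δ ∪ C^W (B^{-W} ∪ K^W)`. -/
def condR {V : Type*} (E : V → V → Prop) (W : Set V) : V → V → Prop := fun a b =>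
  a = b ∨
    Relation.Comp (condC E W) (fun x y => condAscConv E W x y ∨ condK E W x y) a b

/-- Conditional topological closure `cl_W(B) = (E^W)* B`. -/
def clW {V : Type*} (E : V → V → Prop) (W : Set V) (B : Set V) : Set V :=
  foreset (Relation.ReflTransGen (condParent E W)) B

theorem meet_aux {V : Type*} (E : V → V → Prop) (W : Set V) (b x : V) (hb : b ∉ W)
    (h : condAsc E W b x ∨ condK E W b x) :
    ∃ d, Relation.ReflTransGen (condParent E W) d b ∧
      Relation.ReflTransGen (condParent E W) d x := by
  rcases h with ⟨y, hy, hyx⟩ | ⟨d, h1, h2⟩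
  · exact ⟨b, .refl, .head ⟨b, ⟨rfl, hb⟩, hy⟩ hyx⟩
  · exact ⟨d, Relation.TransGen.to_reflTransGen h1, h2.to_reflTransGen⟩

theorem condC_mem {V : Type*} (E : V → V → Prop) (W : Set V) (a b : V)
    (h : condC E W a b) : a ∈ W ∧ b ∈ W := by
  rcases h with h | ⟨rfl, h⟩
  · constructor
    · induction h using Relation.TransGen.head_induction_on with
      | single h => obtain ⟨_, ⟨_, ⟨rfl, h⟩, _⟩, _⟩ := h; exact h
      | head h _ _ => obtain ⟨_, ⟨_, ⟨rfl, h⟩, _⟩, _⟩ := h; exact h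
    · cases h with
      | single h => obtain ⟨_, _, ⟨rfl, h⟩⟩ := h; exact h
      | tail _ h => obtain ⟨_, _, ⟨rfl, h⟩⟩ := h; exact h
  · exact ⟨h, h⟩

theorem clW_inter_ne {V : Type*} (E : V → V → Prop) (W : Set V) (b x : V)
    (h : ∃ d, Relation.ReflTransGen (condParent E W) d b ∧
      Relation.ReflTransGen (condParent E W) d x) :
    clW E W {b} ∩ clW E W {x} ≠ ∅ := by
  obtain ⟨d, h1, h2⟩ := h
  exact Set.Nonempty.ne_empty ⟨d, ⟨b, rfl, h1⟩, ⟨x, rfl, h2⟩⟩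

theorem condK_symm {V : Type*} (E : V → V → Prop) (W : Set V) (b x : V)
    (h : condK E W b x) : condK E W x b := by
  obtain ⟨d, h1, h2⟩ := h
  exact ⟨d, h2, h1⟩

/-- if `B ∩ C = ∅`, `B ∩ W = ∅`, `C ∩ W = ∅`, `b ∈ B`, `c ∈ C`,
`b A^W c` and `cl_W({b}) ∩ cl_W({c}) = ∅`, then there exist `w_b, w_c ∈ W` with
`w_b C^W w_c`, `cl_W({b}) ∩ cl_W({w_b}) ≠ ∅` and `cl_W({c}) ∩ cl_W({w_c}) ≠ ∅`. -/
theorem exists_cousin_witnesses (V : Type*) [Nonempty V] (E : V → V → Prop)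
    (W B C : Set V) (hBC : B ∩ C = ∅) (hBW : B ∩ W = ∅) (hCW : C ∩ W = ∅)
    (b c : V) (hb : b ∈ B) (hc : c ∈ C)
    (hA : condA E W b c) (hdisj : clW E W {b} ∩ clW E W {c} = ∅) :
    ∃ wb ∈ W, ∃ wc ∈ W, condC E W wb wc ∧
      clW E W {b} ∩ clW E W {wb} ≠ ∅ ∧ clW E W {c} ∩ clW E W {wc} ≠ ∅ := by
  have hbW : b ∉ W := fun h => (Set.ext_iff.mp hBW b).mp ⟨hb, h⟩
  have hcW : c ∉ W := fun h => (Set.ext_iff.mp hCW c).mp ⟨hc, h⟩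
  rcases hA with rfl | h | h | h | ⟨wc, ⟨wb, h1, h2⟩, h3⟩
  · exact absurd hdisj (clW_inter_ne E W _ _ ⟨b, .refl, .refl⟩)
  · exact absurd hdisj (clW_inter_ne E W _ _ (meet_aux E W b c hbW (.inl h)))
  · obtain ⟨d, h1, h2⟩ := meet_aux E W c b hcW (.inl h)
    exact absurd hdisj (clW_inter_ne E W _ _ ⟨d, h2, h1⟩)
  · exact absurd hdisj (clW_inter_ne E W _ _ (meet_aux E W b c hbW (.inr h)))
  · obtain ⟨m1, m2⟩ := condC_mem E W _ _ h2
    exact ⟨wb, m1, wc, m2, h2, clW_inter_ne E W _ _ (meet_aux E W b wb hbW h1),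
      clW_inter_ne E W _ _ (meet_aux E W c wc hcW (h3.imp id (condK_symm E W _ _)))⟩
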